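/- arXiv:2310.19729 — 2 statements merged into one kernel-verified Lean document; each statement's English description precedes it below -/
import Mathlib

section
/- (First reality condition.) Let E ∈ M₃(ℂ) be invertible. The following are equivalent: (i) E is real up to a gauge rotation, i.e. there exists a complex orthogonal matrix R ∈ M₃(ℂ) with R Rᵀ = I₃ such that E·R has all real entries; (ii) the matrix E Eᵀ (the densitised inverse spatial metric q q^{ab} = δ^{ij} Ẽ^a_i Ẽ^b_j) is real and positive definite. -/
/- STATEMENT 15 (First reality condition): For an invertible densitised triad E ∈ M₃(ℂ), the
following are equivalent: (i) E is real up to a gauge rotation R ∈ O(3,ℂ) (R Rᵀ = 1, E·R real);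
(ii) E Eᵀ (the densitised inverse spatial metric q q^{ab} = δ^{ij} Ẽ^a_i Ẽ^b_j) is real and
positive definite. -/

open Matrix

noncomputable section

open scoped ComplexOrder MatrixOrder Matrix.Norms.L2Operator in
theorem Matrix.PosSemidef.exists_eq_mul_conjTranspose {n 𝕜 : Type*} [Fintype n] [DecidableEq n]
    [RCLike 𝕜] {A : Matrix n n 𝕜} (hA : A.PosSemidef) : ∃ B : Matrix n n 𝕜, A = B * Bᴴ :=
  CStarAlgebra.nonneg_iff_eq_mul_star_self.mp hA.nonneg

theorem Matrix.map_ofReal_map_re {m n : Type*} {A : Matrix m n ℂ} (hA : ∀ i j, (A i j).im = 0) :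
    (A.map Complex.re).map Complex.ofRealHom = A := by
  ext i j
  exact Complex.ext rfl (hA i j).symm

theorem first_reality_condition (E : Matrix (Fin 3) (Fin 3) ℂ) (hE : IsUnit E) :
    (∃ R : Matrix (Fin 3) (Fin 3) ℂ, R * Rᵀ = 1 ∧ ∀ a i, ((E * R) a i).im = 0) ↔
    ((∀ a b, ((E * Eᵀ) a b).im = 0) ∧ ((E * Eᵀ).map Complex.re).PosDef) := by
  constructor
  · rintro ⟨R, hR, hER⟩
    have hF := map_ofReal_map_re hER
    set F := (E * R).map Complex.re
    have hEF : E * Eᵀ = (F * Fᵀ).map Complex.ofRealHom := by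
      rw [Matrix.map_mul, transpose_map, hF, transpose_mul, Matrix.mul_assoc,
        ← Matrix.mul_assoc R, hR, Matrix.one_mul]
    have hFu : IsUnit F := by
      have hRu : IsUnit R := .of_mul_eq_one _ hR
      have h := hE.mul hRu
      rw [← hF, isUnit_iff_isUnit_det, ← RingHom.mapMatrix_apply, ← RingHom.map_det] at h
      rw [isUnit_iff_isUnit_det]
      exact (isUnit_map_iff Complex.ofRealHom _).mp h
    rw [hEF]
    refine ⟨fun a b => Complex.ofReal_im _, ?_⟩
    rw [← conjTranspose_eq_transpose_of_trivial]
    exact PosDef.mul_conjTranspose_self F (vecMul_injective_of_isUnit hFu)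
  · rintro ⟨him, hpos⟩
    obtain ⟨B, hB⟩ := hpos.posSemidef.exists_eq_mul_conjTranspose
    have hEB : B.map Complex.ofRealHom * (B.map Complex.ofRealHom)ᵀ = E * Eᵀ := by
      rw [← map_ofReal_map_re him, hB, conjTranspose_eq_transpose_of_trivial,
        Matrix.map_mul, transpose_map]
    have hdet : IsUnit E.det := (isUnit_iff_isUnit_det E).mp hE
    refine ⟨E⁻¹ * B.map Complex.ofRealHom, ?_, fun a i => ?_⟩
    · rw [transpose_mul, Matrix.mul_assoc, ← Matrix.mul_assoc (B.map _), hEB,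
        Matrix.mul_assoc, ← transpose_mul, nonsing_inv_mul _ hdet, transpose_one,
        Matrix.mul_one, nonsing_inv_mul _ hdet]
    · rw [mul_nonsing_inv_cancel_left _ _ hdet]
      exact Complex.ofReal_im _

end
end

section
/- Let e^I_a ∈ ℂ (I ∈ {0,1,2,3}, a ∈ {1,2,3}) be such that the complex spatial metric q_{ab} := η_{IJ} e^I_a e^J_b is invertible, with inverse q^{ab}, determinant q := det(q_{ab}) ≠ 0, and a fixed square root √q. Set e^a_I := q^{ab} η_{IJ} e^J_b, define the selfdual Plebanski components Σ^{IJ}_{ab} := (1/2)( e^{[I}_a e^{J]}_b − (i/2) ε^{IJ}{}_{KL} e^K_a e^L_b ), raise indices by Σ^{ab}_{IJ} := q^{ac} q^{bd} η_{IK} η_{JL} Σ^{KL}_{cd}, and let ε^a{}_{bc} := √q · q^{ad} ε̃_{dbc} be the spatial Levi-Civita tensor (ε̃ the permutation symbol, ε̃_{123}=1). Then ε^a{}_{cd} ε^b{}_{ef} Σ^{cd}_{IJ} Σ^{ef}_{KL} η^{IK} η^{JL} = q^{ab}. Consequently the densitised triads Ẽ^a_i := −√q · ε^a{}_{bc} Σ^{bc}_i,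 where Σ^{bc}_i := (P^{-1})^{IJ}{}_i Σ^{bc}_{IJ} with (P^{-1})^{0l}{}_i = (i/2) δ^l_i and (P^{-1})^{kl}{}_i = (1/2) ε_i{}^{kl}, satisfy δ^{ij} Ẽ^a_i Ẽ^b_j = q · q^{ab}: the electric fields are densitised triads for the spatial metric with internal Euclidean metric δ_{ij}. -/
/- STATEMENT 17: For complex frame fields e^I_a with invertible complex spatial metric
q_{ab} = η_{IJ} e^I_a e^J_b, the selfdual Plebanski bi-vectors satisfy
ε^a_{cd} ε^b_{ef} Σ^{cd}_{IJ} Σ^{ef}_{KL} η^{IK} η^{JL} = q^{ab}, and consequently the densitised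
triads Ẽ^a_i = −√q ε^a_{bc} Σ^{bc}_i satisfy δ^{ij} Ẽ^a_i Ẽ^b_j = q q^{ab}. -/
noncomputable section
open Matrix

/-- The Minkowski metric η = diag(−1,+1,+1,+1); its inverse has the same components. -/
def η (I J : Fin 4) : ℂ := if I = J then (if I = 0 then -1 else 1) else 0

/-- The totally antisymmetric Levi-Civita symbol with ε_{0123} = 1 (all indices down). -/
def ε4 (I J K L : Fin 4) : ℂ :=
  ((((J : ℤ) - (I : ℤ)) * ((K : ℤ) - (I : ℤ)) * ((L : ℤ) - (I : ℤ)) *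
    ((K : ℤ) - (J : ℤ)) * ((L : ℤ) - (J : ℤ)) * ((L : ℤ) - (K : ℤ)) : ℤ) : ℂ) / 12

/-- The Levi-Civita symbol with the first index pair raised by η: ε^{IJ}_{KL}. -/
def ε4ud (I J K L : Fin 4) : ℂ := ∑ M : Fin 4, ∑ N : Fin 4, η I M * η J N * ε4 M N K L

/-- The Levi-Civita symbol with the second index pair raised by η: ε_{KL}^{MN}. -/
def ε4du (K L M N : Fin 4) : ℂ := ∑ A : Fin 4, ∑ B : Fin 4, ε4 K L A B * η A M * η B N

/-- Kronecker delta on `Fin 4`, valued in ℂ. -/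
def δ4 (I J : Fin 4) : ℂ := if I = J then 1 else 0

/-- The selfdual projector P^{+IJ}_{KL} = (1/2)(δ^{[I}_K δ^{J]}_L − (i/2) ε^{IJ}_{KL}). -/
def Pp (I J K L : Fin 4) : ℂ :=
  (1 / 2) * ((1 / 2) * (δ4 I K * δ4 J L - δ4 J K * δ4 I L) - (Complex.I / 2) * ε4ud I J K L)

/-- The anti-selfdual projector P^{−IJ}_{KL} = (1/2)(δ^{[I}_K δ^{J]}_L + (i/2) ε^{IJ}_{KL}). -/
def Pm (I J K L : Fin 4) : ℂ :=
  (1 / 2) * ((1 / 2) * (δ4 I K * δ4 J L - δ4 J K * δ4 I L) + (Complex.I / 2) * ε4ud I J K L)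

/-- The totally antisymmetric spatial permutation symbol, ε̃_{123} = 1. -/
def ε3 (i j k : Fin 3) : ℂ :=
  ((((j : ℤ) - (i : ℤ)) * ((k : ℤ) - (i : ℤ)) * ((k : ℤ) - (j : ℤ)) : ℤ) : ℂ) / 2

/-- The inverse isomorphism components (P⁻¹)^{IJ}{}_i (selfdual case):
(P⁻¹)^{0l}_i = (i/2) δ^l_i, extended antisymmetrically in IJ, and (P⁻¹)^{kl}_i = (1/2)ε_i{}^{kl}. -/
def PinvSD (I J : Fin 4) (i : Fin 3) : ℂ :=
  (Complex.I / 2) * (δ4 I 0 * δ4 J i.succ - δ4 J 0 * δ4 I i.succ)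
    + (1 / 2) * ∑ k : Fin 3, ∑ l : Fin 3, δ4 I k.succ * δ4 J l.succ * ε3 i k l

/-- The complex spatial metric q_{ab} = η_{IJ} e^I_a e^J_b. -/
def qmet (e : Fin 4 → Fin 3 → ℂ) : Matrix (Fin 3) (Fin 3) ℂ :=
  Matrix.of fun a b => ∑ I : Fin 4, ∑ J : Fin 4, η I J * e I a * e J b

/-- The selfdual Plebanski components
Σ^{IJ}_{ab} = (1/2)(e^{[I}_a e^{J]}_b − (i/2) ε^{IJ}{}_{KL} e^K_a e^L_b). -/
def Sig (e : Fin 4 → Fin 3 → ℂ) (I J : Fin 4) (a b : Fin 3) : ℂ :=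
  (1 / 2) * ((1 / 2) * (e I a * e J b - e J a * e I b)
    - (Complex.I / 2) * ∑ K : Fin 4, ∑ L : Fin 4, ε4ud I J K L * e K a * e L b)

/-- Σ^{ab}_{IJ}: spatial indices raised with q^{ab}, internal indices lowered with η. -/
def SigUp (e : Fin 4 → Fin 3 → ℂ) (qInv : Matrix (Fin 3) (Fin 3) ℂ)
    (a b : Fin 3) (I J : Fin 4) : ℂ :=
  ∑ c : Fin 3, ∑ d : Fin 3, ∑ K : Fin 4, ∑ L : Fin 4,
    qInv a c * qInv b d * η I K * η J L * Sig e K L c d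

/-- The spatial Levi-Civita tensor ε^a{}_{bc} = √q · q^{ad} ε̃_{dbc}. -/
def epsT (qInv : Matrix (Fin 3) (Fin 3) ℂ) (sq : ℂ) (a b c : Fin 3) : ℂ :=
  sq * ∑ d : Fin 3, qInv a d * ε3 d b c

/-- The densitised triads Ẽ^a_i = −√q · ε^a{}_{bc} Σ^{bc}_i with
Σ^{bc}_i = (P⁻¹)^{IJ}{}_i Σ^{bc}_{IJ}. -/
def Etriad (e : Fin 4 → Fin 3 → ℂ) (qInv : Matrix (Fin 3) (Fin 3) ℂ) (sq : ℂ)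
    (a : Fin 3) (i : Fin 3) : ℂ :=
  - sq * ∑ b : Fin 3, ∑ c : Fin 3, epsT qInv sq a b c *
      (∑ I : Fin 4, ∑ J : Fin 4, PinvSD I J i * SigUp e qInv b c I J)

theorem fin_three_eq (i : Fin 3) : i = 0 ∨ i = 1 ∨ i = 2 := by
  decide +revert

/-- Contraction of a spatial bivector with the permutation symbol. -/
theorem sum_ε3_mul (f : Fin 3 → Fin 3 → ℂ) (a : Fin 3) :
    ∑ b : Fin 3, ∑ c : Fin 3, ε3 a b c * f b c =
      f (a + 1) (a + 2) - f (a + 2) (a + 1) := by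
  obtain rfl | rfl | rfl := fin_three_eq a <;> simp [Fin.sum_univ_three, ε3] <;> ring

/-- The Leibniz formula for a `3 × 3` determinant with free column indices. -/
theorem sum_ε3_mul_cols (Q : Matrix (Fin 3) (Fin 3) ℂ) (a b c : Fin 3) :
    ∑ r : Fin 3, ∑ s : Fin 3, (∑ p : Fin 3, Q p a * ε3 p r s) * (Q r b * Q s c) =
      Q.det * ε3 a b c := by
  obtain rfl | rfl | rfl := fin_three_eq a <;> obtain rfl | rfl | rfl := fin_three_eq b <;>
    obtain rfl | rfl | rfl := fin_three_eq c <;>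
    norm_num [Fin.sum_univ_three, ε3, Matrix.det_fin_three] <;> ring

/-- Lowering an index pair with `η` only changes signs. -/
theorem sum_η_mul_η_mul (f : Fin 4 → Fin 4 → ℂ) (I J : Fin 4) :
    ∑ K : Fin 4, ∑ L : Fin 4, η I K * η J L * f K L = η I I * η J J * f I J := by
  simp [η]

theorem η_mul_self (I : Fin 4) : η I I * η I I = 1 := by
  by_cases h : I = 0 <;> simp [η, h]

/-- The bivector density `ε̃^{abc} Σ^{IJ}_{bc}`. -/
def SigDens (e : Fin 4 → Fin 3 → ℂ) (a : Fin 3) (I J : Fin 4) : ℂ :=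
  ∑ b : Fin 3, ∑ c : Fin 3, ε3 a b c * Sig e I J b c

/-- Raising both spatial indices and dualising amounts to multiplying the density
`ε̃^{abc} Σ_{bc}` by `√q / q`. -/
theorem sum_epsT_mul_SigUp (e : Fin 4 → Fin 3 → ℂ) {Q : Matrix (Fin 3) (Fin 3) ℂ}
    (hQ : Qᵀ = Q) (sq : ℂ) (a : Fin 3) (I J : Fin 4) :
    ∑ c : Fin 3, ∑ d : Fin 3, epsT Q sq a c d * SigUp e Q c d I J =
      sq * Q.det * (η I I * η J J * SigDens e a I J) := by
  have hs : ∀ i j, Q i j = Q j i := fun i j => congrFun (congrFun hQ j) i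
  have hU : ∀ c d, SigUp e Q c d I J =
      ∑ b : Fin 3, ∑ b' : Fin 3, Q c b * Q d b' * (η I I * η J J * Sig e I J b b') := by
    intro c d
    refine Finset.sum_congr rfl fun b _ => Finset.sum_congr rfl fun b' _ => ?_
    rw [← sum_η_mul_η_mul fun K L => Sig e K L b b']
    simp only [Finset.mul_sum, mul_assoc]
  have hT : ∀ c d, epsT Q sq a c d = sq * ∑ p : Fin 3, Q p a * ε3 p c d := by
    intro c d
    simp only [epsT, hs a]
  calc _ = ∑ b : Fin 3, ∑ b' : Fin 3, sq * (∑ c : Fin 3, ∑ d : Fin 3,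
          (∑ p : Fin 3, Q p a * ε3 p c d) * (Q c b * Q d b')) *
            (η I I * η J J * Sig e I J b b') := by
        simp only [hU, hT, Fin.sum_univ_three]
        ring
    _ = _ := by
        simp only [sum_ε3_mul_cols, SigDens, Finset.mul_sum]
        refine Finset.sum_congr rfl fun b _ => Finset.sum_congr rfl fun b' _ => ?_
        ring

theorem Sig_swap (e : Fin 4 → Fin 3 → ℂ) (I J : Fin 4) (b c : Fin 3) :
    Sig e J I b c = -Sig e I J b c := by
  fin_cases I <;> fin_cases J <;>
    norm_num [Sig, ε4ud, ε4, η, Fin.sum_univ_four] <;> ring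

/-- The electric part of the Plebanski bivector. -/
theorem Sig_zero_succ (e : Fin 4 → Fin 3 → ℂ) (i b c : Fin 3) :
    Sig e 0 i.succ b c = (1 / 4) * (e 0 b * e i.succ c - e i.succ b * e 0 c)
      + (Complex.I / 4) * (e (i + 1).succ b * e (i + 2).succ c
        - e (i + 2).succ b * e (i + 1).succ c) := by
  obtain rfl | rfl | rfl := fin_three_eq i <;>
    simp [Sig, ε4ud, ε4, η, Fin.sum_univ_four] <;> ring

/-- Selfduality: the magnetic part is `i` times the electric part, up to sign. -/
theorem Sig_succ_succ (e : Fin 4 → Fin 3 → ℂ) (i b c : Fin 3) :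
    Sig e (i + 1).succ (i + 2).succ b c = -Complex.I * Sig e 0 i.succ b c := by
  rw [Sig_zero_succ]
  obtain rfl | rfl | rfl := fin_three_eq i <;>
    simp [Sig, ε4ud, ε4, η, Fin.sum_univ_four] <;> ring_nf <;> simp <;> ring

theorem SigDens_swap (e : Fin 4 → Fin 3 → ℂ) (a : Fin 3) (I J : Fin 4) :
    SigDens e a J I = -SigDens e a I J := by
  simp only [SigDens, Sig_swap e I J, mul_neg, Finset.sum_neg_distrib]

theorem SigDens_self (e : Fin 4 → Fin 3 → ℂ) (a : Fin 3) (I : Fin 4) :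
    SigDens e a I I = 0 :=
  self_eq_neg.mp (SigDens_swap e a I I)

theorem SigDens_succ_succ (e : Fin 4 → Fin 3 → ℂ) (a i : Fin 3) :
    SigDens e a (i + 1).succ (i + 2).succ = -Complex.I * SigDens e a 0 i.succ := by
  simp only [SigDens, Sig_succ_succ, Finset.mul_sum, mul_left_comm]

/-- The selfdual bivector with electric part `w`. -/
def selfdualBivector (w : Fin 3 → ℂ) : Matrix (Fin 4) (Fin 4) ℂ :=
  !![0, w 0, w 1, w 2;
    -w 0, 0, -Complex.I * w 2, Complex.I * w 1;
    -w 1, Complex.I * w 2, 0, -Complex.I * w 0;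
    -w 2, -Complex.I * w 1, Complex.I * w 0, 0]

theorem SigDens_eq_selfdualBivector (e : Fin 4 → Fin 3 → ℂ) (a : Fin 3) :
    SigDens e a = selfdualBivector fun i => SigDens e a 0 i.succ := by
  have h1 : SigDens e a 2 3 = -Complex.I * SigDens e a 0 1 := SigDens_succ_succ e a 0
  have h2 : SigDens e a 3 1 = -Complex.I * SigDens e a 0 2 := SigDens_succ_succ e a 1
  have h3 : SigDens e a 1 2 = -Complex.I * SigDens e a 0 3 := SigDens_succ_succ e a 2
  ext I J
  fin_cases I <;> fin_cases J <;>
    simp [selfdualBivector, SigDens_self, h1, h2, h3, SigDens_swap e a 0 1,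
      SigDens_swap e a 0 2, SigDens_swap e a 0 3, SigDens_swap e a 2 3, SigDens_swap e a 3 1,
      SigDens_swap e a 1 2]

/-- The Lorentzian product of selfdual bivectors is that of their electric parts. -/
theorem sum_selfdualBivector_mul (w w' : Fin 3 → ℂ) :
    ∑ I : Fin 4, ∑ J : Fin 4,
        η I I * η J J * (selfdualBivector w I J * selfdualBivector w' I J) =
      -4 * ∑ i : Fin 3, w i * w' i := by
  simp [selfdualBivector, Fin.sum_univ_four, Fin.sum_univ_three, η]
  linear_combination (2 * (w 0 * w' 0 + w 1 * w' 1 + w 2 * w' 2)) * Complex.I_mul_I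

/-- The isomorphism `P⁻¹` maps a lowered selfdual bivector to its electric part. -/
theorem sum_PinvSD_mul_selfdualBivector (w : Fin 3 → ℂ) (i : Fin 3) :
    ∑ I : Fin 4, ∑ J : Fin 4, PinvSD I J i * (η I I * η J J * selfdualBivector w I J) =
      -2 * Complex.I * w i := by
  obtain rfl | rfl | rfl := fin_three_eq i <;>
    simp [selfdualBivector, Fin.sum_univ_four, Fin.sum_univ_three, PinvSD, δ4, ε3, η] <;> ring

/-- The electric parts of the densities generate the adjugate of the spatial metric. -/
theorem sum_SigDens_zero_mul (e : Fin 4 → Fin 3 → ℂ) (a b : Fin 3) :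
    -4 * ∑ i : Fin 3, SigDens e a 0 i.succ * SigDens e b 0 i.succ = (qmet e).adjugate a b := by
  have hq : ∀ a b, qmet e a b = -(e 0 a * e 0 b) + e 1 a * e 1 b + e 2 a * e 2 b
      + e 3 a * e 3 b := by
    intro a b
    simp [qmet, η, Fin.sum_univ_four]
  have hD : ∀ a i : Fin 3, SigDens e a 0 i.succ =
      (1 / 2) * (e 0 (a + 1) * e i.succ (a + 2) - e i.succ (a + 1) * e 0 (a + 2))
        + (Complex.I / 2) * (e (i + 1).succ (a + 1) * e (i + 2).succ (a + 2)
          - e (i + 2).succ (a + 1) * e (i + 1).succ (a + 2)) := by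
    intro a i
    rw [SigDens, sum_ε3_mul, Sig_zero_succ, Sig_zero_succ]
    ring
  simp_rw [hD, Fin.sum_univ_three, Matrix.adjugate_fin_three]
  obtain rfl | rfl | rfl := fin_three_eq a <;> obtain rfl | rfl | rfl := fin_three_eq b <;>
    simp [hq] <;> ring_nf <;> simp <;> ring

theorem qmet_transpose (e : Fin 4 → Fin 3 → ℂ) : (qmet e)ᵀ = qmet e := by
  ext a b
  simp [qmet, η, Fin.sum_univ_four, mul_comm]

theorem sum_sum_comm {α β γ δ : Type*} [Fintype α] [Fintype β] [Fintype γ] [Fintype δ]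
    (F : α → β → γ → δ → ℂ) :
    ∑ p, ∑ r, ∑ s, ∑ t, F p r s t = ∑ s, ∑ t, ∑ p, ∑ r, F p r s t := by
  rw [← Fintype.sum_prod_type' fun p r => ∑ s, ∑ t, F p r s t, Finset.sum_comm]
  refine Finset.sum_congr rfl fun s _ => ?_
  rw [Finset.sum_comm]
  exact Finset.sum_congr rfl fun t _ => Fintype.sum_prod_type' fun p r => F p r s t

/-- Rearranging a double contraction into a product of single ones. -/
theorem sum_contraction {α β : Type*} [Fintype α] [Fintype β] (x y : α → ℂ) (A B : α → β → ℂ)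
    (g : β → β → ℂ) :
    ∑ p, ∑ r, ∑ s, ∑ t, x p * y r * A p s * B r t * g s t =
      ∑ s, ∑ t, g s t * ((∑ p, x p * A p s) * ∑ r, y r * B r t) := by
  simp_rw [Finset.sum_mul_sum, Finset.mul_sum]
  rw [sum_sum_comm]
  refine Finset.sum_congr rfl fun s _ => Finset.sum_congr rfl fun t _ =>
    Finset.sum_congr rfl fun p _ => Finset.sum_congr rfl fun r _ => ?_
  ring

theorem electric_fields_are_densitised_triads
    (e : Fin 4 → Fin 3 → ℂ) (qInv : Matrix (Fin 3) (Fin 3) ℂ) (sq : ℂ)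
    (hq₁ : qmet e * qInv = 1) (hq₂ : qInv * qmet e = 1)
    (hqdet : (qmet e).det ≠ 0) (hsq : sq ^ 2 = (qmet e).det) :
    -- ε^a_{cd} ε^b_{ef} Σ^{cd}_{IJ} Σ^{ef}_{KL} η^{IK} η^{JL} = q^{ab}
    (∀ a b : Fin 3,
      (∑ c : Fin 3, ∑ d : Fin 3, ∑ e' : Fin 3, ∑ f : Fin 3,
        ∑ I : Fin 4, ∑ J : Fin 4, ∑ K : Fin 4, ∑ L : Fin 4,
          epsT qInv sq a c d * epsT qInv sq b e' f *
            SigUp e qInv c d I J * SigUp e qInv e' f K L * η I K * η J L)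
        = qInv a b) ∧
    -- δ^{ij} Ẽ^a_i Ẽ^b_j = q q^{ab}
    (∀ a b : Fin 3,
      (∑ i : Fin 3, Etriad e qInv sq a i * Etriad e qInv sq b i)
        = (qmet e).det * qInv a b) := by
  have hQT : qInvᵀ = qInv := by
    have h : qInvᵀ * qmet e = 1 := by
      rw [← qmet_transpose e, ← Matrix.transpose_mul, hq₁, Matrix.transpose_one]
    exact left_inv_eq_right_inv h hq₁
  have hdet : qInv.det * (qmet e).det = 1 := by
    rw [← Matrix.det_mul, hq₂, Matrix.det_one]
  have hadj : ∀ a b, (qmet e).adjugate a b = (qmet e).det * qInv a b := by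
    intro a b
    have h : (qmet e).adjugate = (qmet e).det • qInv := by
      rw [← one_mul (qmet e).adjugate, ← hq₂, Matrix.mul_assoc, Matrix.mul_adjugate,
        Matrix.mul_smul, Matrix.mul_one]
    rw [h, Matrix.smul_apply, smul_eq_mul]
  have hC := sum_epsT_mul_SigUp e hQT sq
  refine ⟨fun a b => ?_, fun a b => ?_⟩
  · calc _ = ∑ I : Fin 4, ∑ J : Fin 4, ∑ K : Fin 4, ∑ L : Fin 4, η I K * η J L *
          ((∑ c : Fin 3, ∑ d : Fin 3, epsT qInv sq a c d * SigUp e qInv c d I J) *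
            ∑ c : Fin 3, ∑ d : Fin 3, epsT qInv sq b c d * SigUp e qInv c d K L) := by
          have h := sum_contraction (fun p : Fin 3 × Fin 3 => epsT qInv sq a p.1 p.2)
            (fun p => epsT qInv sq b p.1 p.2)
            (fun p (s : Fin 4 × Fin 4) => SigUp e qInv p.1 p.2 s.1 s.2)
            (fun p s => SigUp e qInv p.1 p.2 s.1 s.2) (fun s t => η s.1 t.1 * η s.2 t.2)
          simpa only [Fintype.sum_prod_type, ← mul_assoc] using h
      _ = (sq * qInv.det) ^ 2 * ∑ I : Fin 4, ∑ J : Fin 4,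
          η I I * η J J * (SigDens e a I J * SigDens e b I J) := by
          simp only [sum_η_mul_η_mul, hC, Finset.mul_sum]
          refine Finset.sum_congr rfl fun I _ => Finset.sum_congr rfl fun J _ => ?_
          linear_combination (sq * qInv.det) ^ 2 * η I I * η J J *
            SigDens e a I J * SigDens e b I J *
              (η J J * η J J * η_mul_self I + η_mul_self J)
      _ = _ := by
          rw [SigDens_eq_selfdualBivector e a, SigDens_eq_selfdualBivector e b,
            sum_selfdualBivector_mul, sum_SigDens_zero_mul, hadj, mul_pow, hsq]
          linear_combination qInv a b * (qInv.det * (qmet e).det + 1) * hdet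
  · have hE : ∀ a i, Etriad e qInv sq a i = 2 * Complex.I * SigDens e a 0 i.succ := by
      intro a i
      calc _ = -sq * ∑ I : Fin 4, ∑ J : Fin 4, PinvSD I J i *
            ∑ c : Fin 3, ∑ d : Fin 3, epsT qInv sq a c d * SigUp e qInv c d I J := by
            rw [Etriad]
            congr 1
            simp only [Finset.mul_sum]
            rw [sum_sum_comm]
            simp only [mul_left_comm]
        _ = -(sq ^ 2 * qInv.det) * ∑ I : Fin 4, ∑ J : Fin 4,
            PinvSD I J i * (η I I * η J J * SigDens e a I J) := by
            simp only [hC, Finset.mul_sum]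
            refine Finset.sum_congr rfl fun I _ => Finset.sum_congr rfl fun J _ => ?_
            ring
        _ = _ := by
            conv_lhs => rw [SigDens_eq_selfdualBivector e a]
            rw [sum_PinvSD_mul_selfdualBivector, hsq]
            linear_combination 2 * Complex.I * SigDens e a 0 i.succ * hdet
    rw [← hadj, ← sum_SigDens_zero_mul, Finset.mul_sum]
    refine Finset.sum_congr rfl fun i _ => ?_
    rw [hE, hE]
    linear_combination 4 * SigDens e a 0 i.succ * SigDens e b 0 i.succ * Complex.I_mul_I

end
end
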